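/- Let X be a real normed space and let p be a real number with p ≤ 0 (equivalently p/(2−p) ≤ 0). Then for all nonzero x, y ∈ X, α_p[x,y] ≤ ((4 − 3p)/(2 − p)) · (max(‖x‖^p, ‖y‖^p) / max(‖x‖·‖y‖^{p−1}, ‖y‖·‖x‖^{p−1})) · β_p[x,y]. -/

import Mathlib

open Filter

/-- The `p`-angular distance `α_p[x,y] = ‖ ‖x‖^(p-1) • x − ‖y‖^(p-1) • y ‖`. -/
noncomputable def alphaP {X : Type*} [NormedAddCommGroup X] [NormedSpace ℝ X]
    (p : ℝ) (x y : X) : ℝ :=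
  ‖(‖x‖ ^ (p - 1)) • x - (‖y‖ ^ (p - 1)) • y‖

/-- The skew `p`-angular distance `β_p[x,y] = ‖ ‖y‖^(p-1) • x − ‖x‖^(p-1) • y ‖`. -/
noncomputable def betaP {X : Type*} [NormedAddCommGroup X] [NormedSpace ℝ X]
    (p : ℝ) (x y : X) : ℝ :=
  ‖(‖y‖ ^ (p - 1)) • x - (‖x‖ ^ (p - 1)) • y‖

/-- The Maligranda–Rooin constant `MR_p(X)`. -/
noncomputable def MRconst (X : Type*) [NormedAddCommGroup X] [NormedSpace ℝ X]
    (p : ℝ) : ℝ :=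
  sSup { r : ℝ | ∃ x y : X, x ≠ 0 ∧ y ≠ 0 ∧ betaP p x y ≠ 0 ∧
    r = alphaP p x y / betaP p x y }

/-- A scalar estimate for `z ^ θ` obtained from Bernoulli's inequality at `z` and at `z⁻¹`. -/
theorem one_add_rpow_sub_two_mul_le {z θ : ℝ} (hz0 : 0 < z) (hz1 : z ≤ 1)
    (hθ0 : 0 ≤ θ) (hθ1 : θ ≤ 1) :
    1 + z ^ θ - 2 * z ^ θ * z ≤ (2 + θ) * (1 - z) := by
  have hupper : z ^ θ ≤ 1 + θ * (z - 1) := by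
    simpa using rpow_one_add_le_one_add_mul_self (s := z - 1) (by linarith) hθ0 hθ1
  have hlower : z ≤ z ^ θ * (z + θ * (1 - z)) := by
    have hinv : 0 < z⁻¹ := inv_pos.mpr hz0
    have h : (z⁻¹) ^ θ ≤ 1 + θ * (z⁻¹ - 1) := by
      simpa using rpow_one_add_le_one_add_mul_self (s := z⁻¹ - 1) (by linarith) hθ0 hθ1
    have hw : 0 < z ^ θ := Real.rpow_pos_of_pos hz0 θ
    rw [Real.inv_rpow hz0.le, inv_le_iff_one_le_mul₀ hw] at h
    calc z = z * 1 := (mul_one z).symm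
      _ ≤ z * ((1 + θ * (z⁻¹ - 1)) * z ^ θ) := by gcongr
      _ = z ^ θ * (z + θ * (1 - z)) := by field_simp
  rcases le_total (2 * z) 1 with h | h
  · nlinarith [mul_le_mul_of_nonneg_right hupper (sub_nonneg.mpr h),
      mul_nonneg hθ0 (sq_nonneg (1 - z))]
  · have hpos : 0 < z + θ * (1 - z) := by nlinarith
    have hmul := mul_le_mul_of_nonneg_right hlower (sub_nonneg.mpr h)
    have hsq : 0 ≤ (θ + θ ^ 2) * (1 - z) ^ 2 := by positivity
    refine le_of_mul_le_mul_right ?_ hpos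
    nlinarith

/-- Comparison of two perturbed differences of unit vectors. -/
theorem norm_sub_rpow_smul_le {X : Type*} [NormedAddCommGroup X] [NormedSpace ℝ X]
    {e f : X} (he : ‖e‖ = 1) (hf : ‖f‖ = 1) {z θ : ℝ} (hz0 : 0 < z) (hz1 : z ≤ 1)
    (hθ0 : 0 ≤ θ) (hθ1 : θ ≤ 1) :
    ‖e - z ^ θ • f‖ ≤ (2 + θ) * ‖z • e - f‖ := by
  have hw0 : 0 < z ^ θ := Real.rpow_pos_of_pos hz0 θ
  have hw1 : z ^ θ ≤ 1 := Real.rpow_le_one hz0.le hz1 hθ0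
  have hscalar := one_add_rpow_sub_two_mul_le hz0 hz1 hθ0 hθ1
  set w := z ^ θ
  have hwz : w * z ≤ 1 := mul_le_one₀ hw1 hz0.le hz1
  have hupper : ‖e - w • f‖ ≤ w * ‖z • e - f‖ + (1 - w * z) := by
    have heq : e - w • f = w • (z • e - f) + (1 - w * z) • e := by module
    rw [heq]
    refine (norm_add_le _ _).trans_eq ?_
    rw [norm_smul, norm_smul, he, Real.norm_of_nonneg hw0.le,
      Real.norm_of_nonneg (sub_nonneg.mpr hwz), mul_one]
  have hlower : 1 - z ≤ ‖z • e - f‖ := by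
    have h := norm_sub_norm_le f (z • e)
    rwa [norm_smul, he, hf, Real.norm_of_nonneg hz0.le, mul_one, norm_sub_rev] at h
  rcases hz1.eq_or_lt with rfl | hlt
  · have hw : w = 1 := Real.one_rpow θ
    rw [hw] at hupper ⊢
    nlinarith [norm_nonneg ((1 : ℝ) • e - f)]
  · refine le_of_mul_le_mul_right ?_ (sub_pos.mpr hlt)
    have h1 := mul_le_mul_of_nonneg_right hupper (sub_nonneg.mpr hz1)
    have h2 := mul_le_mul_of_nonneg_left hlower (sub_nonneg.mpr hwz)
    have h3 := mul_le_mul_of_nonneg_right hscalar (norm_nonneg (z • e - f))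
    nlinarith

theorem alphaP_comm {X : Type*} [NormedAddCommGroup X] [NormedSpace ℝ X]
    (p : ℝ) (x y : X) : alphaP p x y = alphaP p y x :=
  norm_sub_rev _ _

theorem betaP_comm {X : Type*} [NormedAddCommGroup X] [NormedSpace ℝ X]
    (p : ℝ) (x y : X) : betaP p x y = betaP p y x :=
  norm_sub_rev _ _

theorem alphaP_le_of_norm_le {X : Type*} [NormedAddCommGroup X] [NormedSpace ℝ X]
    {p : ℝ} (hp : p ≤ 0) {x y : X} (hx : x ≠ 0) (hy : y ≠ 0) (hxy : ‖x‖ ≤ ‖y‖) :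
    alphaP p x y ≤ ((4 - 3 * p) / (2 - p)) *
      (max (‖x‖ ^ p) (‖y‖ ^ p) / max (‖x‖ * ‖y‖ ^ (p - 1)) (‖y‖ * ‖x‖ ^ (p - 1))) *
      betaP p x y := by
  have ha : 0 < ‖x‖ := norm_pos_iff.mpr hx
  have hb : 0 < ‖y‖ := norm_pos_iff.mpr hy
  have he : ‖‖x‖⁻¹ • x‖ = 1 := norm_smul_inv_norm (𝕜 := ℝ) hx
  have hf : ‖‖y‖⁻¹ • y‖ = 1 := norm_smul_inv_norm (𝕜 := ℝ) hy
  have hq : 0 < 2 - p := by linarith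
  unfold alphaP betaP
  rw [max_eq_left (Real.rpow_le_rpow_of_nonpos ha hxy hp),
    max_eq_right (mul_le_mul hxy (Real.rpow_le_rpow_of_nonpos ha hxy (by linarith))
      (by positivity) hb.le)]
  set a := ‖x‖
  set b := ‖y‖
  have hap : 0 < a ^ p := Real.rpow_pos_of_pos ha p
  have hbp : 0 < b ^ p := Real.rpow_pos_of_pos hb p
  have hab : 0 < a / b := div_pos ha hb
  have hmain := norm_sub_rpow_smul_le he hf (z := (a / b) ^ (2 - p)) (θ := -p / (2 - p))
    (Real.rpow_pos_of_pos hab _)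
    (Real.rpow_le_one hab.le ((div_le_one hb).mpr hxy) hq.le)
    (div_nonneg (by linarith) hq.le) ((div_le_one hq).mpr (by linarith))
  rw [← Real.rpow_mul hab.le, mul_div_cancel₀ _ hq.ne'] at hmain
  have hα : a ^ (p - 1) • x - b ^ (p - 1) • y
      = a ^ p • (a⁻¹ • x - (a / b) ^ (-p) • b⁻¹ • y) := by
    rw [smul_sub, smul_smul, smul_smul, smul_smul]
    congr 2
    · rw [Real.rpow_sub_one ha.ne', div_eq_mul_inv]
    · rw [Real.rpow_sub_one hb.ne', Real.rpow_neg hab.le, Real.div_rpow ha.le hb.le]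
      field_simp
  have hβ : b ^ (p - 1) • x - a ^ (p - 1) • y
      = (b * a ^ (p - 1)) • ((a / b) ^ (2 - p) • a⁻¹ • x - b⁻¹ • y) := by
    rw [smul_sub, smul_smul, smul_smul, smul_smul]
    congr 2
    · rw [Real.rpow_sub_one hb.ne', Real.rpow_sub_one ha.ne', Real.rpow_sub hab,
        Real.div_rpow ha.le hb.le p, Real.rpow_two]
      field_simp
    · field_simp
  have hc : 0 < b * a ^ (p - 1) := mul_pos hb (Real.rpow_pos_of_pos ha _)
  rw [hα, hβ, norm_smul, norm_smul, Real.norm_of_nonneg hap.le, Real.norm_of_nonneg hc.le]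
  refine (mul_le_mul_of_nonneg_left hmain hap.le).trans_eq ?_
  field_simp
  ring

theorem stmt5 (X : Type*) [NormedAddCommGroup X] [NormedSpace ℝ X]
    (p : ℝ) (hp : p ≤ 0)
    (x y : X) (hx : x ≠ 0) (hy : y ≠ 0) :
    alphaP p x y ≤ ((4 - 3 * p) / (2 - p)) *
      (max (‖x‖ ^ p) (‖y‖ ^ p) / max (‖x‖ * ‖y‖ ^ (p - 1)) (‖y‖ * ‖x‖ ^ (p - 1))) *
      betaP p x y := by
  rcases le_total ‖x‖ ‖y‖ with h | h
  · exact alphaP_le_of_norm_le hp hx hy h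
  · rw [alphaP_comm, betaP_comm, max_comm (‖x‖ ^ p), max_comm (‖x‖ * ‖y‖ ^ (p - 1))]
    exact alphaP_le_of_norm_le hp hy hx h
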